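/- Let n ≥ 2. If f is a polynomial function on N that is homogeneous of degree n(n−1), is SO_n-invariant, and vanishes identically on F, then f = c·δ for some real scalar c. In other words, up to scalar multiples, δ is the only degree n(n−1) homogeneous SO_n-invariant polynomial function on N vanishing on F. -/

import Mathlib

open Matrix BigOperators

/-- A real symmetric matrix is Hermitian. -/
theorem isHermitian_of_isSymm {n : ℕ} {A : Matrix (Fin n) (Fin n) ℝ} (h : A.IsSymm) :
    A.IsHermitian := by
  rw [Matrix.IsHermitian, Matrix.conjTranspose_eq_transpose_of_trivial]
  exact h

/-- The discriminant of a real symmetric (Hermitian) matrix: the product of the squared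
differences of its eigenvalues. -/
noncomputable def disc {n : ℕ} (A : Matrix (Fin n) (Fin n) ℝ) (hA : A.IsHermitian) : ℝ :=
  ∏ i : Fin n, ∏ j ∈ Finset.Ioi i, (hA.eigenvalues i - hA.eigenvalues j) ^ 2

/-- The space `N` of trace-zero real symmetric `n × n` matrices, as a submodule. -/
def symTraceless (n : ℕ) : Submodule ℝ (Matrix (Fin n) (Fin n) ℝ) where
  carrier := {A | A.IsSymm ∧ A.trace = 0}
  add_mem' := by
    rintro A B ⟨hA1, hA2⟩ ⟨hB1, hB2⟩
    refine ⟨?_, ?_⟩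
    · rw [Matrix.IsSymm, Matrix.transpose_add, hA1, hB1]
    · rw [Matrix.trace_add, hA2, hB2, add_zero]
  zero_mem' := ⟨by rw [Matrix.IsSymm, Matrix.transpose_zero], by simp⟩
  smul_mem' := by
    rintro c A ⟨h1, h2⟩
    refine ⟨?_, ?_⟩
    · rw [Matrix.IsSymm, Matrix.transpose_smul, h1]
    · rw [Matrix.trace_smul, h2, smul_zero]

theorem mem_symTraceless {n : ℕ} {A : Matrix (Fin n) (Fin n) ℝ} :
    A ∈ symTraceless n ↔ A.IsSymm ∧ A.trace = 0 := Iff.rfl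

/-- The eigenvalues of a trace-zero real symmetric matrix. -/
noncomputable def eigsN {n : ℕ} (A : symTraceless n) : Fin n → ℝ :=
  (isHermitian_of_isSymm (mem_symTraceless.mp A.2).1).eigenvalues

/-- A trace-zero symmetric matrix is degenerate if it has a repeated eigenvalue. -/
def Degen {n : ℕ} (A : symTraceless n) : Prop :=
  ∃ i j : Fin n, i ≠ j ∧ eigsN A i = eigsN A j

/-- The discriminant, as a function on trace-zero symmetric matrices. -/
noncomputable def discN {n : ℕ} (A : symTraceless n) : ℝ :=
  ∏ i : Fin n, ∏ j ∈ Finset.Ioi i, (eigsN A i - eigsN A j) ^ 2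

/-- Evaluation of a polynomial in the matrix entries at a matrix. -/
noncomputable def evalMat {n : ℕ} (p : MvPolynomial (Fin n × Fin n) ℝ)
    (A : Matrix (Fin n) (Fin n) ℝ) : ℝ :=
  MvPolynomial.eval (fun ij => A ij.1 ij.2) p

/-- The action `A ↦ gᵀ A g` of an orthogonal matrix on trace-zero symmetric matrices. -/
def soConj {n : ℕ} (g : Matrix (Fin n) (Fin n) ℝ) (hg : gᵀ * g = 1)
    (A : symTraceless n) : symTraceless n :=
  ⟨gᵀ * A.1 * g, by
    obtain ⟨h1, h2⟩ := mem_symTraceless.mp A.2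
    refine mem_symTraceless.mpr ⟨?_, ?_⟩
    · rw [Matrix.IsSymm, Matrix.transpose_mul, Matrix.transpose_mul,
        Matrix.transpose_transpose, h1, Matrix.mul_assoc]
    · rw [Matrix.trace_mul_cycle, mul_eq_one_comm.mp hg,
        Matrix.one_mul, h2]⟩

/-- `H_i(A) = A^i - (Tr(A^i)/n)·I`. -/
noncomputable def Hmat {n : ℕ} (A : Matrix (Fin n) (Fin n) ℝ) (i : ℕ) :
    Matrix (Fin n) (Fin n) ℝ :=
  A ^ i - ((A ^ i).trace / (n : ℝ)) • 1

theorem aux_eval {σ τ : Type*} (f : σ → MvPolynomial τ ℝ) (x : τ → ℝ) (q : MvPolynomial σ ℝ) :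
    MvPolynomial.eval x (MvPolynomial.aeval f q) =
      MvPolynomial.eval (fun k => MvPolynomial.eval x (f k)) q := by
  induction q using MvPolynomial.induction_on with
  | C a => simp
  | add p q hp hq => simp only [map_add, hp, hq]
  | mul_X p i hp => simp only [map_mul, hp, MvPolynomial.aeval_X, MvPolynomial.eval_X]

open MvPolynomial in
theorem aux_dvd {n : ℕ} (q : MvPolynomial (Fin n) ℝ) (i j : Fin n)
    (h : ∀ x : Fin n → ℝ, x i = x j → eval x q = 0) : (X i - X j) ∣ q := by
  classical
  let f : Fin n → MvPolynomial (Fin n) ℝ := fun k => if k = i then X j else X k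
  have h0 : aeval f q = 0 := by
    apply MvPolynomial.funext
    intro x
    have := h (fun k => eval x (f k)) (by by_cases hij : j = i <;> simp [f, hij])
    rw [map_zero, ← this, aux_eval]
  have h1 : (Ideal.Quotient.mkₐ ℝ (Ideal.span {(X i - X j : MvPolynomial (Fin n) ℝ)})).comp
      (aeval f) = Ideal.Quotient.mkₐ ℝ _ := by
    apply MvPolynomial.algHom_ext
    intro k
    by_cases hk : k = i
    · subst hk
      simp only [AlgHom.comp_apply, aeval_X, f, if_true, Ideal.Quotient.mkₐ_eq_mk]
      symm
      rw [Ideal.Quotient.eq]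
      exact Ideal.mem_span_singleton_self _
    · simp [f, hk]
  have h2 := DFunLike.congr_fun h1 q
  rw [AlgHom.comp_apply, h0, map_zero, Ideal.Quotient.mkₐ_eq_mk] at h2
  exact Ideal.mem_span_singleton.mp (Ideal.Quotient.eq_zero_iff_mem.mp h2.symm)

open MvPolynomial in
theorem aux_sq_dvd {n : ℕ} (q : MvPolynomial (Fin n) ℝ) (i j : Fin n) (hij : i ≠ j)
    (h : ∀ x : Fin n → ℝ, x i = x j → eval x q = 0)
    (hs : ∀ x : Fin n → ℝ, eval (x ∘ Equiv.swap i j) q = eval x q) : (X i - X j) ^ 2 ∣ q := by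
  obtain ⟨r, rfl⟩ := aux_dvd q i j h
  rw [pow_two]
  apply mul_dvd_mul_left
  have hX : (X i - X j : MvPolynomial (Fin n) ℝ) ≠ 0 := by
    rw [sub_ne_zero]
    exact fun hh => hij (X_injective hh)
  have hr : rename (Equiv.swap i j) r = - r := by
    apply mul_left_cancel₀ hX
    apply MvPolynomial.funext
    intro x
    have := hs x
    simp [eval_rename] at this ⊢
    linarith
  apply aux_dvd
  intro x hx
  have h3 := congrArg (eval x) hr
  rw [eval_rename, map_neg] at h3
  have : x ∘ (Equiv.swap i j) = x := by
    funext k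
    simp only [Function.comp, Equiv.swap_apply_def]
    split_ifs <;> simp_all
  rw [this] at h3
  linarith

open MvPolynomial in
theorem aux_irred {n : ℕ} (i j : Fin n) (hij : i ≠ j) :
    Irreducible (X i - X j : MvPolynomial (Fin n) ℝ) := by
  have := irreducible_mul_X_add (R := ℝ) (1 : MvPolynomial (Fin n) ℝ) (-X j) i one_ne_zero
    (by simp) (by simp [hij]) isRelPrime_one_left
  simpa [sub_eq_add_neg] using this

open MvPolynomial in
theorem aux_rel {n : ℕ} (i j k l : Fin n) (hij : i < j) (hkl : k < l)
    (hne : ¬ (i = k ∧ j = l)) :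
    IsRelPrime (X i - X j : MvPolynomial (Fin n) ℝ) (X k - X l) := by
  rw [(aux_irred i j hij.ne).isRelPrime_iff_not_dvd]
  rintro ⟨r, hr⟩
  have := congrArg (eval (fun t => if t = i ∨ t = j then (0:ℝ) else if t = k then 1 else 2)) hr
  simp at this
  have h1 := hkl.ne
  split_ifs at this <;> first | (norm_num at this; done) | grind

theorem aux_card (n : ℕ) : ∑ i : Fin n, (Finset.Ioi i).card * 2 = n * (n - 1) := by
  rw [← Finset.sum_mul]
  simp only [Fin.card_Ioi]
  rw [Fin.sum_univ_eq_sum_range (fun i => n - 1 - i), Finset.sum_range_reflect (fun i => i),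
    Finset.sum_range_id_mul_two]

open MvPolynomial in
theorem aux_poly {n : ℕ} (q : MvPolynomial (Fin n) ℝ) (hd : q.IsHomogeneous (n * (n - 1)))
    (h : ∀ x : Fin n → ℝ, ∀ i j, i ≠ j → x i = x j → eval x q = 0)
    (hs : ∀ (x : Fin n → ℝ) (s : Equiv.Perm (Fin n)), eval (x ∘ s) q = eval x q) :
    ∃ c : ℝ, ∀ x, eval x q = c * ∏ i : Fin n, ∏ j ∈ Finset.Ioi i, (x i - x j) ^ 2 := by
  have hdvd : (∏ a ∈ (Finset.univ : Finset (Fin n)).sigma (fun i => Finset.Ioi i),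
      (X a.1 - X a.2 : MvPolynomial (Fin n) ℝ) ^ 2) ∣ q := by
    apply Finset.prod_dvd_of_isRelPrime
    · rintro ⟨i, j⟩ hi ⟨k, l⟩ hk hne
      simp at hi hk
      apply IsRelPrime.pow
      apply aux_rel _ _ _ _ hi hk
      rintro ⟨rfl, rfl⟩
      exact hne rfl
    · rintro ⟨i, j⟩ hi
      simp at hi
      exact aux_sq_dvd q i j hi.ne (fun x => h x i j hi.ne) (fun x => hs x _)
  rw [Finset.prod_sigma] at hdvd
  have hP : (∏ i : Fin n, ∏ j ∈ Finset.Ioi i,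
      (X i - X j : MvPolynomial (Fin n) ℝ) ^ 2).IsHomogeneous (n * (n - 1)) := by
    rw [← aux_card]
    apply IsHomogeneous.prod
    intro i _
    rw [Finset.card_eq_sum_ones, Finset.sum_mul]
    apply IsHomogeneous.prod
    intro j _
    exact ((isHomogeneous_X ℝ i).sub (isHomogeneous_X ℝ j)).pow 2
  obtain ⟨r, hr⟩ := hdvd
  by_cases hq : q = 0
  · exact ⟨0, fun x => by simp [hq]⟩
  have hP0 := left_ne_zero_of_mul (hr ▸ hq)
  have hr0 := right_ne_zero_of_mul (hr ▸ hq)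
  have hdeg := totalDegree_mul_of_isDomain hP0 hr0
  rw [← hr, hd.totalDegree hq, hP.totalDegree hP0] at hdeg
  have hr1 : r.totalDegree = 0 := by omega
  rw [totalDegree_eq_zero_iff_eq_C] at hr1
  refine ⟨coeff 0 r, fun x => ?_⟩
  rw [hr, map_mul, hr1, mul_comm]
  simp

theorem aux_orth {n : ℕ} (hn : 2 ≤ n)
    (p : MvPolynomial (Fin n × Fin n) ℝ)
    (hinv : ∀ (g : Matrix (Fin n) (Fin n) ℝ), gᵀ * g = 1 → g.det = 1 →
      ∀ A : ↥(symTraceless n), evalMat p (gᵀ * A.1 * g) = evalMat p A.1)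
    (g : Matrix (Fin n) (Fin n) ℝ) (hg : gᵀ * g = 1) (d : Fin n → ℝ) (hd : ∑ i, d i = 0) :
    evalMat p (gᵀ * diagonal d * g) = evalMat p (diagonal d) := by
  have hD : diagonal d ∈ symTraceless n :=
    mem_symTraceless.mpr ⟨by simp [Matrix.IsSymm], by simpa [Matrix.trace_diagonal] using hd⟩
  have hdet : g.det * g.det = 1 := by
    have := congrArg Matrix.det hg
    simpa using this
  rcases mul_self_eq_one_iff.mp hdet with h1 | h1
  · exact hinv g hg h1 ⟨_, hD⟩
  · let e : Fin n → ℝ := Function.update 1 ⟨0, by omega⟩ (-1)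
    have he : ∀ i, e i * e i = 1 := by
      intro i
      by_cases hi : i = ⟨0, by omega⟩
      · subst hi; simp [e]
      · simp [e, hi]
    have hee : diagonal e * diagonal e = 1 := by
      simp [diagonal_mul_diagonal, he]
    have hede : diagonal e * diagonal d * diagonal e = diagonal d := by
      rw [diagonal_mul_diagonal, diagonal_mul_diagonal]
      congr 1
      funext i
      linear_combination d i * he i
    have := hinv (diagonal e * g) (by
      rw [transpose_mul, diagonal_transpose, Matrix.mul_assoc, ← Matrix.mul_assoc (diagonal e),
        hee, Matrix.one_mul, hg]) (by
      rw [det_mul, h1, det_diagonal]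
      simp [e, Finset.prod_update_of_mem]) ⟨_, hD⟩
    rw [← this]
    congr 1
    rw [transpose_mul, diagonal_transpose]
    conv_lhs => rw [← hede]
    simp only [Matrix.mul_assoc]

theorem aux_degen {n : ℕ} (d : Fin n → ℝ) (hD : diagonal d ∈ symTraceless n) (i j : Fin n)
    (hij : i ≠ j) (h : d i = d j) : Degen (⟨_, hD⟩ : symTraceless n) := by
  by_contra hc
  have hinj : Function.Injective (eigsN (⟨_, hD⟩ : symTraceless n)) := by
    intro a b hab
    by_contra hne
    exact hc ⟨a, b, hne, hab⟩
  have h1 := (isHermitian_of_isSymm (mem_symTraceless.mp hD).1).roots_charpoly_eq_eigenvalues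
  have h2 : (diagonal d).charpoly = ∏ i, (Polynomial.X - Polynomial.C (d i)) := by
    simp [Matrix.charpoly, Matrix.charmatrix, Matrix.scalar_apply, Matrix.diagonal_map]
  have h4 : (∏ i, (Polynomial.X - Polynomial.C (d i))).roots = Multiset.map d Finset.univ.val := by
    have := Polynomial.roots_multiset_prod_X_sub_C (Multiset.map d Finset.univ.val)
    rwa [Multiset.map_map] at this
  rw [h2, h4] at h1
  have h3 : (Multiset.map d Finset.univ.val).Nodup := by
    rw [h1]
    exact Finset.univ.nodup.map hinj
  exact hij (Multiset.inj_on_of_nodup_map h3 i (by simp) j (by simp) h)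

/-- Up to scalar multiples, the discriminant is the only degree-`n(n-1)` homogeneous
`SO_n`-invariant polynomial function on the space `N` of trace-zero real symmetric matrices
vanishing on the set `F` of degenerate matrices. -/
theorem eq_smul_discriminant_of_invariant (n : ℕ) (hn : 2 ≤ n)
    (p : MvPolynomial (Fin n × Fin n) ℝ)
    (hhom : p.IsHomogeneous (n * (n - 1)))
    (hinv : ∀ (g : Matrix (Fin n) (Fin n) ℝ), gᵀ * g = 1 → g.det = 1 →
      ∀ A : ↥(symTraceless n), evalMat p (gᵀ * A.1 * g) = evalMat p A.1)
    (hvan : ∀ A : ↥(symTraceless n), Degen A → evalMat p A.1 = 0) :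
    ∃ c : ℝ, ∀ A : ↥(symTraceless n), evalMat p A.1 = c * discN A := by
  have hn0 : (n : ℝ) ≠ 0 := by positivity
  let f : Fin n × Fin n → MvPolynomial (Fin n) ℝ := fun ij =>
    if ij.1 = ij.2 then MvPolynomial.X ij.1 -
      MvPolynomial.C ((n : ℝ)⁻¹) * ∑ k, MvPolynomial.X k else 0
  let m : (Fin n → ℝ) → Fin n → ℝ := fun x i => x i - (n : ℝ)⁻¹ * ∑ k, x k
  have hm : ∀ x, ∑ i, m x i = 0 := by
    intro x
    simp only [m, Finset.sum_sub_distrib, Finset.sum_const, Finset.card_univ, Fintype.card_fin,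
      nsmul_eq_mul]
    field_simp
    simp
  have hmem : ∀ x, diagonal (m x) ∈ symTraceless n := fun x =>
    mem_symTraceless.mpr ⟨by simp [Matrix.IsSymm], by simpa [Matrix.trace_diagonal] using hm x⟩
  have hev : ∀ x, MvPolynomial.eval x (MvPolynomial.aeval f p) = evalMat p (diagonal (m x)) := by
    intro x
    rw [aux_eval, evalMat]
    congr 2
    funext ij
    by_cases hij : ij.1 = ij.2
    · simp [f, m, hij]
    · simp [f, hij]
  have hhomq : (MvPolynomial.aeval f p).IsHomogeneous (n * (n - 1)) := by
    have := hhom.aeval (n := 1) f (by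
      intro ij
      by_cases hij : ij.1 = ij.2
      · simp only [f, hij, if_true]
        refine (MvPolynomial.isHomogeneous_X _ _).sub ?_
        have h0 := (MvPolynomial.isHomogeneous_C (Fin n) ((n : ℝ)⁻¹)).mul
          (MvPolynomial.IsHomogeneous.sum Finset.univ (fun k : Fin n => MvPolynomial.X k) 1
            (fun k _ => MvPolynomial.isHomogeneous_X ℝ k))
        simpa using h0
      · simp only [f, hij, if_false]
        exact MvPolynomial.isHomogeneous_zero _ _ _)
    rwa [one_mul] at this
  obtain ⟨c, hc⟩ := aux_poly _ hhomq (by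
    intro x i j hij hx
    rw [hev]
    exact hvan ⟨_, hmem x⟩ (aux_degen _ (hmem x) i j hij (by simp [m, hx]))) (by
    intro x s
    rw [hev, hev]
    have h1 := aux_orth hn p hinv (s.permMatrix ℝ)ᵀ (by
      rw [transpose_transpose]
      ext a b
      simp [Equiv.Perm.permMatrix, PEquiv.toMatrix_toPEquiv_mul, Matrix.one_apply,
        PEquiv.toMatrix_apply]) (m x) (hm x)
    rw [← h1]
    congr 1
    ext a b
    have hsum : ∑ k, x (s k) = ∑ k, x k := Equiv.sum_comp s x
    simp [Equiv.Perm.permMatrix, PEquiv.toMatrix_toPEquiv_mul, diagonal_apply, Matrix.mul_apply,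
        PEquiv.toMatrix_apply, m, hsum]
    symm
    refine (Finset.sum_eq_single (s a) ?_ ?_).trans ?_
    · intro k _ hk
      simp [hk.symm]
    · simp
    · simp)
  refine ⟨c, fun A => ?_⟩
  have hA := isHermitian_of_isSymm (mem_symTraceless.mp A.2).1
  have hsum : ∑ i, eigsN A i = 0 := by
    have := hA.trace_eq_sum_eigenvalues
    rw [(mem_symTraceless.mp A.2).2] at this
    simpa [eigsN] using this.symm
  have hme : m (eigsN A) = eigsN A := by
    funext i
    simp [m, hsum]
  have := hc (eigsN A)
  rw [hev, hme] at this
  rw [discN, ← this]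
  let U : Matrix (Fin n) (Fin n) ℝ := hA.eigenvectorUnitary
  have hU : U * Uᵀ = 1 := by
    have := Unitary.mul_star_self_of_mem hA.eigenvectorUnitary.2
    rwa [Matrix.star_eq_conjTranspose, conjTranspose_eq_transpose_of_trivial] at this
  have h2 := aux_orth hn p hinv Uᵀ (by rwa [transpose_transpose]) (eigsN A) hsum
  rw [← h2]
  congr 1
  have h3 := hA.spectral_theorem
  rw [Unitary.conjStarAlgAut_apply, Matrix.star_eq_conjTranspose,
    conjTranspose_eq_transpose_of_trivial] at h3
  rw [transpose_transpose]
  exact h3
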